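/- Weak maximum principle bound for the advected Q-tensor equation: under c > 0, ζ > 0, a ≥ −cη, 0 < η < (1/9)(ζ/L₄)², let u be a sufficiently regular divergence-free vector field on 𝕋² × [0,T] and Q a sufficiently regular solution of ∂_tQ + u·∇Q + Qω − ωQ = ζΔQ + 2L₄∂_k(∂_lQ Q_{lk}) − L₄(∂_iQ_{kl}∂_jQ_{kl}) + (L₄/2)|∇Q|²I − aQ − c tr(Q²)Q on 𝕋², with ‖Q(·,0)‖_{L^∞} ≤ √η. Then ‖Q(·,t)‖_{L^∞} ≤ √η for all t ∈ [0,T]. -/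

import Mathlib

open MeasureTheory

/-- Partial derivative in direction `i` of a function on `ℝ²`. -/
noncomputable def pd (i : Fin 2) (f : (Fin 2 → ℝ) → ℝ) : (Fin 2 → ℝ) → ℝ :=
  fun x => fderiv ℝ f x (Pi.single i 1)

/-- The fundamental cell `[0,1]²` of the torus `𝕋²`. -/
def T2 : Set (Fin 2 → ℝ) := Set.univ.pi fun _ => Set.Icc (0:ℝ) 1

/-- `f` is `1`-periodic in each coordinate direction (i.e. lives on the torus `𝕋²`). -/
def Per (f : (Fin 2 → ℝ) → ℝ) : Prop :=
  ∀ (x : Fin 2 → ℝ) (i : Fin 2), f (x + Pi.single i 1) = f x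

theorem hasDerivAt_line {f : (Fin 2 → ℝ) → ℝ} (hf : Differentiable ℝ f)
    (x v : Fin 2 → ℝ) (s : ℝ) :
    HasDerivAt (fun r : ℝ => f (x + r • v)) (∑ k, v k * pd k f (x + s • v)) s := by
  have h1 : HasDerivAt (fun r : ℝ => x + r • v) v s := by
    simpa using ((hasDerivAt_id s).smul_const v).const_add x
  have h2 := (hf (x + s • v)).hasFDerivAt.comp_hasDerivAt s h1
  refine h2.congr_deriv ?_
  have hv : v = ∑ k, v k • (Pi.single k 1 : Fin 2 → ℝ) := by
    ext i; fin_cases i <;> simp [Fin.sum_univ_two]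
  calc fderiv ℝ f (x + s • v) v
      = fderiv ℝ f (x + s • v) (∑ k, v k • (Pi.single k 1 : Fin 2 → ℝ)) := by rw [← hv]
    _ = ∑ k, v k * pd k f (x + s • v) := by
      simp only [map_sum, map_smul, smul_eq_mul, pd]

theorem ContDiff.pd {f : (Fin 2 → ℝ) → ℝ} (hf : ContDiff ℝ (⊤ : ℕ∞) f) (k : Fin 2) :
    ContDiff ℝ (⊤ : ℕ∞) (pd k f) :=
  ((contDiff_infty_iff_fderiv.1 hf).2).clm_apply contDiff_const

theorem pd_mul {f g : (Fin 2 → ℝ) → ℝ} {x : Fin 2 → ℝ} (hf : DifferentiableAt ℝ f x)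
    (hg : DifferentiableAt ℝ g x) (k : Fin 2) :
    pd k (fun y => f y * g y) x = pd k f x * g x + f x * pd k g x := by
  simp only [pd, fderiv_fun_mul hf hg]
  simp
  ring

theorem pd_add {f g : (Fin 2 → ℝ) → ℝ} {x : Fin 2 → ℝ} (hf : DifferentiableAt ℝ f x)
    (hg : DifferentiableAt ℝ g x) (k : Fin 2) :
    pd k (fun y => f y + g y) x = pd k f x + pd k g x := by
  simp [pd, fderiv_fun_add hf hg]

theorem pd_neg (f : (Fin 2 → ℝ) → ℝ) (x : Fin 2 → ℝ) (k : Fin 2) :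
    pd k (fun y => -f y) x = -pd k f x := by
  simp [pd, fderiv_fun_neg]

theorem pd_eq_zero_of_forall_le {f : (Fin 2 → ℝ) → ℝ} {x : Fin 2 → ℝ}
    (hmax : ∀ y, f y ≤ f x) (k : Fin 2) : pd k f x = 0 := by
  have : IsLocalMax f x := Filter.Eventually.of_forall hmax
  simp [pd, this.fderiv_eq_zero]

/-- At a global maximum, second derivatives in every direction are nonpositive. -/
theorem sum_pd_pd_nonpos_of_forall_le {f : (Fin 2 → ℝ) → ℝ} (hf : ContDiff ℝ (⊤ : ℕ∞) f)
    {x : Fin 2 → ℝ} (hmax : ∀ y, f y ≤ f x) (v : Fin 2 → ℝ) :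
    ∑ l, v l * ∑ k, v k * pd k (pd l f) x ≤ 0 := by
  have d1 : deriv (fun r : ℝ => f (x + r • v)) = fun s => ∑ l, v l * pd l f (x + s • v) :=
    funext fun s => (hasDerivAt_line (hf.differentiable (by simp)) x v s).deriv
  have d2 : deriv (deriv (fun r : ℝ => f (x + r • v))) 0
      = ∑ l, v l * ∑ k, v k * pd k (pd l f) x := by
    rw [d1]
    refine HasDerivAt.deriv (HasDerivAt.fun_sum fun l _ => HasDerivAt.const_mul _ ?_)
    simpa using hasDerivAt_line ((hf.pd l).differentiable (by simp)) x v 0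
  rw [← d2]
  by_contra! hpos
  have hlmax : IsLocalMax (fun r : ℝ => f (x + r • v)) 0 :=
    Filter.Eventually.of_forall fun r => by simpa using hmax (x + r • v)
  have hcont : ContinuousAt (fun r : ℝ => f (x + r • v)) 0 :=
    (hasDerivAt_line (hf.differentiable (by simp)) x v 0).continuousAt
  have hlmin := isLocalMin_of_deriv_deriv_pos hpos hlmax.deriv_eq_zero hcont
  have hconst : (fun r : ℝ => f (x + r • v)) =ᶠ[nhds 0] fun _ => f (x + (0 : ℝ) • v) := by
    filter_upwards [hlmax, hlmin] with r h1 h2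
    exact le_antisymm h1 h2
  have := hconst.deriv.deriv_eq
  simp only [deriv_const'] at this
  linarith

theorem deriv_nonneg_of_forall_lt_le {g : ℝ → ℝ} {t : ℝ} (hg : DifferentiableAt ℝ g t)
    (ht : 0 < t) (h : ∀ s, 0 ≤ s → s < t → g s ≤ g t) : 0 ≤ deriv g t := by
  have h1 := (hasDerivAt_iff_tendsto_slope.1 hg.hasDerivAt).mono_left
    (nhdsWithin_mono t (s := Set.Iio t) fun y hy => ne_of_lt hy)
  refine ge_of_tendsto h1 ?_
  filter_upwards [Ioo_mem_nhdsLT ht] with s hs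
  rw [slope_def_field]
  exact div_nonneg_of_nonpos (by linarith [h s hs.1.le hs.2]) (by linarith [hs.2])

/-- A periodic function takes all its values on the fundamental cell. -/
theorem Per.exists_mem_T2 {ι : Type*} {F : ι → (Fin 2 → ℝ) → ℝ} (hF : ∀ i, Per (F i))
    (x : Fin 2 → ℝ) : ∃ y ∈ T2, ∀ i, F i y = F i x := by
  refine ⟨fun k => Int.fract (x k), fun k _ => ⟨Int.fract_nonneg _, (Int.fract_lt_one _).le⟩,
    fun i => ?_⟩
  have hper (k : Fin 2) : Function.Periodic (F i) (Pi.single k (1 : ℝ)) := fun y => hF i y k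
  have h0 := (hper 0).int_mul ⌊x 0⌋
  have h1 := (hper 1).int_mul ⌊x 1⌋
  rw [← h0, ← h1]
  congr 1
  ext k
  fin_cases k <;> simp [← Int.self_sub_floor]

theorem quadratic_nonneg {α β γ : ℝ} (hα : 0 < α) (hdet : β ^ 2 ≤ α * γ) (x y : ℝ) :
    0 ≤ α * x ^ 2 + 2 * β * x * y + γ * y ^ 2 := by
  have : 0 ≤ α * (α * x ^ 2 + 2 * β * x * y + γ * y ^ 2) := by
    nlinarith [sq_nonneg (α * x + β * y), mul_nonneg (sub_nonneg.2 hdet) (sq_nonneg y)]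
  exact nonneg_of_mul_nonneg_right this hα

/-- The contraction of a positive semidefinite and a negative semidefinite form is nonpositive. -/
theorem contraction_nonpos {α β γ h₁ h₂ h₃ : ℝ} (hα : 0 < α) (hdet : β ^ 2 ≤ α * γ)
    (hH : ∀ x y : ℝ, h₁ * x ^ 2 + h₂ * x * y + h₃ * y ^ 2 ≤ 0) :
    α * h₁ + β * h₂ + γ * h₃ ≤ 0 := by
  have h : α * (α * h₁ + β * h₂ + γ * h₃) ≤ 0 := by
    have h3 : h₃ ≤ 0 := by simpa using hH 0 1
    nlinarith [hH α β, mul_nonneg (sub_nonneg.2 hdet) (neg_nonneg.2 h3)]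
  exact nonpos_of_mul_nonpos_right h hα

/-- A periodic continuous function exceeding `m` somewhere but initially below `m` first
reaches the value `m` at a positive time, at a spatial maximum. -/
theorem exists_first_time {w : ℝ → (Fin 2 → ℝ) → ℝ} (hper : ∀ t, Per (w t))
    (hcont : Continuous fun p : ℝ × (Fin 2 → ℝ) => w p.1 p.2) {T m : ℝ}
    (hinit : ∀ x, w 0 x < m) {t₁ : ℝ} (ht₁ : t₁ ∈ Set.Icc 0 T) {x₁ : Fin 2 → ℝ}
    (hx₁ : m ≤ w t₁ x₁) :
    ∃ t ∈ Set.Ioc 0 T, ∃ x, w t x = m ∧ (∀ y, w t y ≤ m) ∧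
      ∀ s, 0 ≤ s → s < t → w s x ≤ m := by
  let K : Set (ℝ × (Fin 2 → ℝ)) := (Set.Icc 0 T ×ˢ T2) ∩ {p | m ≤ w p.1 p.2}
  have hK : IsCompact K := (isCompact_Icc.prod (isCompact_univ_pi fun _ => isCompact_Icc)).inter_right
    (isClosed_le continuous_const hcont)
  have hmemK {s : ℝ} (hs : s ∈ Set.Icc 0 T) {y : Fin 2 → ℝ} (hy : m ≤ w s y) :
      ∃ z, (s, z) ∈ K := by
    obtain ⟨z, hz, hzy⟩ := Per.exists_mem_T2 (fun _ : Unit => hper s) y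
    exact ⟨z, ⟨hs, hz⟩, by simpa [hzy ()] using hy⟩
  obtain ⟨z₁, hz₁⟩ := hmemK ht₁ hx₁
  obtain ⟨⟨t, x⟩, ⟨⟨ht, -⟩, hm⟩, hmin⟩ := hK.exists_isMinOn ⟨_, hz₁⟩ continuous_fst.continuousOn
  simp only [Set.mem_ofPred_eq] at hm ht
  have hbefore : ∀ s, 0 ≤ s → s < t → ∀ y, w s y ≤ m := by
    intro s hs hst y
    by_contra! hlt
    obtain ⟨z, hz⟩ := hmemK ⟨hs, hst.le.trans ht.2⟩ hlt.le
    exact absurd (hmin hz) (not_le.2 hst)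
  have ht0 : 0 < t := by
    refine lt_of_le_of_ne ht.1 ?_
    rintro rfl
    exact absurd (hinit x) (not_lt.2 hm)
  have hat : ∀ y, w t y ≤ m := by
    intro y
    have hc : Continuous fun s => w s y := hcont.comp (by fun_prop : Continuous fun s : ℝ => (s, y))
    refine le_of_tendsto (hc.continuousWithinAt (s := Set.Iio t) (x := t)) ?_
    filter_upwards [Ioo_mem_nhdsLT ht0] with s hs
    exact hbefore s hs.1.le hs.2 y
  exact ⟨t, ⟨ht0, ht.2⟩, x, le_antisymm (hat x) hm, hat, fun s hs hst => hbefore s hs hst x⟩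

theorem pd_sum_sq {P R : (Fin 2 → ℝ) → ℝ} (hP : Differentiable ℝ P) (hR : Differentiable ℝ R)
    (k : Fin 2) :
    pd k (fun y => P y * P y + R y * R y) = fun y => 2 * (P y * pd k P y + R y * pd k R y) := by
  ext y
  rw [pd_add (by fun_prop) (by fun_prop), pd_mul (hP y) (hP y), pd_mul (hR y) (hR y)]
  ring

theorem pd_pd_sum_sq {P R : (Fin 2 → ℝ) → ℝ} (hP : ContDiff ℝ (⊤ : ℕ∞) P)
    (hR : ContDiff ℝ (⊤ : ℕ∞) R) (k l : Fin 2) (x : Fin 2 → ℝ) :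
    pd k (pd l (fun y => P y * P y + R y * R y)) x
      = 2 * (pd k P x * pd l P x + P x * pd k (pd l P) x
        + (pd k R x * pd l R x + R x * pd k (pd l R) x)) := by
  have dP : Differentiable ℝ P := hP.differentiable (by simp)
  have dR : Differentiable ℝ R := hR.differentiable (by simp)
  have dP' : Differentiable ℝ (pd l P) := (hP.pd l).differentiable (by simp)
  have dR' : Differentiable ℝ (pd l R) := (hR.pd l).differentiable (by simp)
  have h2 : (fun y => 2 * (P y * pd l P y + R y * pd l R y)) =
      fun y => (P y * pd l P y + R y * pd l R y) + (P y * pd l P y + R y * pd l R y) := by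
    ext y
    ring
  rw [pd_sum_sq dP dR, h2, pd_add (by fun_prop) (by fun_prop), pd_add (by fun_prop) (by fun_prop),
    pd_mul (dP x) (dP' x), pd_mul (dR x) (dR' x)]
  ring

/-- Weak maximum principle for the advected Q-tensor equation: under `c > 0`, `ζ > 0`,
`a ≥ −cη`, `0 < η < (1/9)(ζ/L₄)²`, if `u` is a (sufficiently regular) divergence-free
periodic vector field and `Q : 𝕋² × [0,T] → 𝒮₀^{(2)}` a (sufficiently regular) solution of
`∂ₜQ + u·∇Q + Qω − ωQ = ζΔQ + 2L₄∂ₖ(∂ₗQ Q_{lk}) − L₄(∂ᵢQ_{kl}∂ⱼQ_{kl})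
 + (L₄/2)|∇Q|² I − aQ − c tr(Q²)Q` with `‖Q(·,0)‖_{L^∞} ≤ √η`, then
`‖Q(·,t)‖_{L^∞} ≤ √η` for all `t ∈ [0,T]` (stated as `|Q(x,t)|² ≤ η` pointwise). -/
theorem weak_maximum_principle (T ζ L₄ a c η : ℝ)
    (hT : 0 ≤ T) (hc : 0 < c) (hζ : 0 < ζ)
    (hη : 0 < η) (hη' : η < (1/9) * (ζ / L₄)^2) (ha : a ≥ -c * η)
    (u : ℝ → (Fin 2 → ℝ) → Fin 2 → ℝ)
    (Q : ℝ → (Fin 2 → ℝ) → Matrix (Fin 2) (Fin 2) ℝ)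
    (hu : ∀ i, ContDiff ℝ (⊤ : ℕ∞) (fun p : ℝ × (Fin 2 → ℝ) => u p.1 p.2 i))
    (hup : ∀ t i, Per (fun x => u t x i))
    (hdiv : ∀ t x, ∑ k, pd k (fun y => u t y k) x = 0)
    (hQ : ∀ i j, ContDiff ℝ (⊤ : ℕ∞) (fun p : ℝ × (Fin 2 → ℝ) => Q p.1 p.2 i j))
    (hQp : ∀ t i j, Per (fun x => Q t x i j))
    (hsym : ∀ t x, (Q t x).IsSymm) (htr : ∀ t x, (Q t x).trace = 0)
    (heq : ∀ t ∈ Set.Icc (0:ℝ) T, ∀ (x : Fin 2 → ℝ) (i j : Fin 2),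
      deriv (fun s => Q s x i j) t
        + (∑ k, u t x k * pd k (fun y => Q t y i j) x)
        + (∑ k, (Q t x i k
              * ((pd j (fun y => u t y k) x - pd k (fun y => u t y j) x) / 2)
            - ((pd k (fun y => u t y i) x - pd i (fun y => u t y k) x) / 2)
              * Q t x k j))
      = ζ * (∑ k, pd k (pd k (fun y => Q t y i j)) x)
        + 2 * L₄ * (∑ k, pd k (fun y =>
            ∑ l, pd l (fun z => Q t z i j) y * Q t y l k) x)
        - L₄ * (∑ k, ∑ l,
            pd i (fun z => Q t z k l) x * pd j (fun z => Q t z k l) x)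
        + (L₄ / 2) * (∑ m, ∑ k, ∑ l, (pd m (fun z => Q t z k l) x)^2)
            * (if i = j then 1 else 0)
        - a * Q t x i j - c * (Q t x * Q t x).trace * Q t x i j)
    (hinit : ∀ x, ∑ i, ∑ j, (Q 0 x i j)^2 ≤ η) :
    ∀ t ∈ Set.Icc (0:ℝ) T, ∀ x, ∑ i, ∑ j, (Q t x i j)^2 ≤ η := by
  intro t₁ ht₁ x₁
  by_contra! hgt
  have h11 (t x) : Q t x 1 1 = -Q t x 0 0 := by
    have := htr t x
    rw [Matrix.trace_fin_two] at this
    linarith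
  have h10 (t x) : Q t x 1 0 = Q t x 0 1 := (hsym t x).apply 0 1
  have hw (t x) : ∑ i, ∑ j, (Q t x i j) ^ 2 = 2 * ((Q t x 0 0) ^ 2 + (Q t x 0 1) ^ 2) := by
    simp only [Fin.sum_univ_two, h11, h10]
    ring
  have hL : L₄ ≠ 0 := by
    rintro rfl
    simp at hη'
    linarith
  simp only [hw] at hinit hgt
  obtain ⟨m, hηm, hm⟩ := exists_between (lt_min hη' hgt)
  obtain ⟨hmζ, hm₁⟩ := lt_min_iff.1 hm
  have hmζ' : 9 * L₄ ^ 2 * m < ζ ^ 2 := by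
    have hL2 : 0 < L₄ ^ 2 := by positivity
    rw [div_pow, mul_div_assoc', lt_div_iff₀ hL2] at hmζ
    linarith
  obtain ⟨t, ht, x, hwm, hmax, hpast⟩ := exists_first_time
    (w := fun t x => 2 * ((Q t x 0 0) ^ 2 + (Q t x 0 1) ^ 2))
    (fun t y i => by simp only [hQp t 0 0 y i, hQp t 0 1 y i])
    (by have := (hQ 0 0).continuous; have := (hQ 0 1).continuous; fun_prop)
    (fun y => (hinit y).trans_lt hηm) ht₁ hm₁.le
  have hP : ContDiff ℝ (⊤ : ℕ∞) (fun y => Q t y 0 0) :=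
    (hQ 0 0).comp (contDiff_prodMk_right t)
  have hR : ContDiff ℝ (⊤ : ℕ∞) (fun y => Q t y 0 1) :=
    (hQ 0 1).comp (contDiff_prodMk_right t)
  have hPt : DifferentiableAt ℝ (fun s => Q s x 0 0) t :=
    ((hQ 0 0).comp (contDiff_prodMk_left x)).differentiable (by simp) t
  have hRt : DifferentiableAt ℝ (fun s => Q s x 0 1) t :=
    ((hQ 0 1).comp (contDiff_prodMk_left x)).differentiable (by simp) t
  have htime := deriv_nonneg_of_forall_lt_le
    (g := fun s => 2 * ((Q s x 0 0) ^ 2 + (Q s x 0 1) ^ 2)) (by fun_prop) ht.1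
    (fun s hs hst => (hpast s hs hst).trans_eq hwm.symm)
  have hwt : HasDerivAt (fun s => 2 * ((Q s x 0 0) ^ 2 + (Q s x 0 1) ^ 2)) _ t :=
    ((hPt.hasDerivAt.pow 2).add (hRt.hasDerivAt.pow 2)).const_mul 2
  rw [hwt.deriv] at htime
  clear hwt hpast
  have e00 := heq t ⟨ht.1.le, ht.2⟩ x 0 0
  have e01 := heq t ⟨ht.1.le, ht.2⟩ x 0 1
  simp only [Fin.sum_univ_two, Matrix.trace_fin_two, Matrix.mul_apply, h11, h10] at e00 e01
  generalize hp : (fun y => Q t y 0 0) = P at *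
  generalize hr : (fun y => Q t y 0 1) = R at *
  have hp' (y) : Q t y 0 0 = P y := congrFun hp y
  have hr' (y) : Q t y 0 1 = R y := congrFun hr y
  simp only [hp', hr'] at e00 e01 htime hmax hwm
  have dP : Differentiable ℝ P := hP.differentiable (by simp)
  have dR : Differentiable ℝ R := hR.differentiable (by simp)
  have dP' (k) : Differentiable ℝ (pd k P) := (hP.pd k).differentiable (by simp)
  have dR' (k) : Differentiable ℝ (pd k R) := (hR.pd k).differentiable (by simp)
  have hmax' : ∀ y, P y * P y + R y * R y ≤ P x * P x + R x * R x := fun y => by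
    have := (hmax y).trans_eq hwm.symm
    linarith
  have hgrad (k) : P x * pd k P x + R x * pd k R x = 0 := by
    have := pd_eq_zero_of_forall_le (f := fun y => P y * P y + R y * R y) hmax' k
    rw [pd_sum_sq dP dR] at this
    simpa using this
  have hhess (v₀ v₁ : ℝ) := sum_pd_pd_nonpos_of_forall_le
    (f := fun y => P y * P y + R y * R y) (by fun_prop) hmax' ![v₀, v₁]
  simp only [Fin.sum_univ_two, pd_pd_sum_sq hP hR, Matrix.cons_val_zero, Matrix.cons_val_one]
    at hhess
  have hg0 := hgrad 0
  have hg1 := hgrad 1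
  simp (disch := fun_prop) only [pd_add, pd_mul, pd_neg] at e00 e01
  norm_num at e00 e01 htime
  have hpr : 9 * L₄ ^ 2 * (2 * (P x ^ 2 + R x ^ 2)) < ζ ^ 2 := by rwa [hwm]
  have hLP : 0 ≤ L₄ ^ 2 * P x ^ 2 := by positivity
  have hLR : 0 ≤ L₄ ^ 2 * R x ^ 2 := by positivity
  have hA₀ : 0 < ζ + 2 * L₄ * P x := by
    have : (2 * L₄ * P x) ^ 2 < ζ ^ 2 := by nlinarith only [hpr, hLP, hLR]
    linarith [(abs_lt.1 (abs_lt_of_sq_lt_sq this hζ.le)).1]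
  have hB₀ : 0 < ζ + 3 * L₄ * P x := by
    have : (3 * L₄ * P x) ^ 2 < ζ ^ 2 := by nlinarith only [hpr, hLP, hLR]
    linarith [(abs_lt.1 (abs_lt_of_sq_lt_sq this hζ.le)).1]
  have hAdet : (2 * L₄ * R x) ^ 2 ≤ (ζ + 2 * L₄ * P x) * (ζ - 2 * L₄ * P x) := by
    nlinarith only [hpr, hLP, hLR]
  have hBdet : (3 * L₄ * R x) ^ 2 ≤ (ζ + 3 * L₄ * P x) * (ζ - 3 * L₄ * P x) := by
    nlinarith only [hpr, hLP, hLR]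
  have hdiff := contraction_nonpos hA₀ hAdet
    (h₁ := pd 0 P x * pd 0 P x + P x * pd 0 (pd 0 P) x
      + (pd 0 R x * pd 0 R x + R x * pd 0 (pd 0 R) x))
    (h₂ := pd 1 P x * pd 0 P x + P x * pd 1 (pd 0 P) x
      + (pd 1 R x * pd 0 R x + R x * pd 1 (pd 0 R) x)
      + (pd 0 P x * pd 1 P x + P x * pd 0 (pd 1 P) x
      + (pd 0 R x * pd 1 R x + R x * pd 0 (pd 1 R) x)))
    (h₃ := pd 1 P x * pd 1 P x + P x * pd 1 (pd 1 P) x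
      + (pd 1 R x * pd 1 R x + R x * pd 1 (pd 1 R) x))
    (fun y z => by linarith only [hhess y z])
  have hgradP := quadratic_nonneg hB₀ hBdet (pd 0 P x) (pd 1 P x)
  have hgradR := quadratic_nonneg hB₀ hBdet (pd 0 R x) (pd 1 R x)
  have hreact : 0 < (a + c * m) * m :=
    mul_pos (by nlinarith only [ha, mul_lt_mul_of_pos_left hηm hc]) (hη.trans hηm)
  rw [← hwm] at hreact
  refine lt_irrefl (0 : ℝ) ?_
  linear_combination hreact + 2 * hdiff + 2 * hgradP + 2 * hgradR + htime
    + 2 * P x * e00 + 2 * R x * e01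
    + (-2 * u t x 0 + 4 * L₄ * (pd 0 P x + pd 1 R x)) * hg0
    + (-2 * u t x 1 + 4 * L₄ * (pd 0 R x - pd 1 P x)) * hg1
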